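/- arXiv:1902.02023 — 2 statements merged into one kernel-verified Lean document; each statement's English description precedes it below -/
import Mathlib

section
/- Correctness of the set-cover correspondence in the packet dropping reduction: let X be a finite set of rhythmic packets, W : X → Finset ℕ assign to each rhythmic packet x its time window with the windows W x pairwise disjoint, let J be a finite set of periodic packets, and T : J → Finset ℕ assign to each periodic packet its set of transmission slots. For a set ρ ⊆ J of dropped periodic packets, say that ρ accommodates all rhythmic packets if there exists an injective function g : X → ℕ such that for every x, g x ∈ W x and g x ∈ T j for some j ∈ ρ. Then ρ accommodates all rhythmic packets if and only if for every x ∈ X there exists j ∈ ρ with W x ∩ T j ≠ ∅; equivalently, writing C j = {x ∈ X : W x ∩ T j ≠ ∅}, ρ accommodates all rhythmic packets if and only if ⋃_{j ∈ ρ} C j = X. -/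
/-- Correctness of the set-cover correspondence in the packet dropping reduction:
a set ρ of dropped periodic packets accommodates all rhythmic packets iff every
rhythmic packet's window meets the transmission slots of some dropped packet,
equivalently iff the sets C j = {x ∈ X : W x ∩ T j ≠ ∅} for j ∈ ρ cover X. -/
theorem packet_drop_set_cover_correspondence {α β : Type*} [DecidableEq α] [DecidableEq β]
    (X : Finset α) (W : α → Finset ℕ)
    (hW : ∀ x ∈ X, ∀ y ∈ X, x ≠ y → Disjoint (W x) (W y))
    (J : Finset β) (T : β → Finset ℕ) (ρ : Finset β) (hρ : ρ ⊆ J) :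
    ((∃ g : α → ℕ, Set.InjOn g ↑X ∧ ∀ x ∈ X, g x ∈ W x ∧ ∃ j ∈ ρ, g x ∈ T j) ↔
      ∀ x ∈ X, ∃ j ∈ ρ, (W x ∩ T j).Nonempty) ∧
    ((∃ g : α → ℕ, Set.InjOn g ↑X ∧ ∀ x ∈ X, g x ∈ W x ∧ ∃ j ∈ ρ, g x ∈ T j) ↔
      ρ.biUnion (fun j => X.filter (fun x => (W x ∩ T j).Nonempty)) = X) := by
  have accommodates_iff :
      (∃ g : α → ℕ, Set.InjOn g ↑X ∧ ∀ x ∈ X, g x ∈ W x ∧ ∃ j ∈ ρ, g x ∈ T j) ↔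
        ∀ x ∈ X, ∃ j ∈ ρ, (W x ∩ T j).Nonempty := by
    constructor
    · rintro ⟨g, -, hg⟩ x hx
      obtain ⟨hgW, j, hj, hgT⟩ := hg x hx
      exact ⟨j, hj, g x, Finset.mem_inter.2 ⟨hgW, hgT⟩⟩
    · intro h
      have slot : ∀ x, ∃ n, x ∈ X → n ∈ W x ∧ ∃ j ∈ ρ, n ∈ T j := by
        intro x
        by_cases hx : x ∈ X
        · obtain ⟨j, hj, n, hn⟩ := h x hx
          rw [Finset.mem_inter] at hn
          exact ⟨n, fun _ => ⟨hn.1, j, hj, hn.2⟩⟩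
        · exact ⟨0, fun hx' => absurd hx' hx⟩
      choose g hg using slot
      refine ⟨g, fun x hx y hy hxy => ?_, hg⟩
      by_contra hne
      exact Finset.disjoint_left.1 (hW x hx y hy hne) (hg x hx).1 (hxy ▸ (hg y hy).1)
  refine ⟨accommodates_iff, accommodates_iff.trans ⟨fun h => ?_, fun h x hx => ?_⟩⟩
  · ext x
    simp only [Finset.mem_biUnion, Finset.mem_filter]
    constructor
    · rintro ⟨_, _, hx, _⟩
      exact hx
    · intro hx
      obtain ⟨j, hj, hne⟩ := h x hx
      exact ⟨j, hj, hx, hne⟩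
  · rw [← h] at hx
    simp only [Finset.mem_biUnion, Finset.mem_filter] at hx
    obtain ⟨j, hj, _, hne⟩ := hx
    exact ⟨j, hj, hne⟩
end

section
/- Optimum preservation in the packet dropping reduction: let X be a finite set of rhythmic packets, W : X → Finset ℕ assign pairwise disjoint time windows, J a finite set of periodic packets, T : J → Finset ℕ their transmission slot sets, and C j = {x ∈ X : W x ∩ T j ≠ ∅}. Assume ⋃_{j ∈ J} C j = X (so the full family covers X). Then the minimum cardinality of a set ρ ⊆ J that accommodates all rhythmic packets (i.e., admits an injective g : X → ℕ with g x ∈ W x and g x ∈ ⋃_{j ∈ ρ} T j) equals the minimum cardinality of a subfamily ρ ⊆ J with ⋃_{j ∈ ρ} C j = X. In particular, one can determine a minimum dropped packet set accommodating all rhythmic packets if and only if one can identify a smallest sub-collection of {C j} covering X. -/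
/-- With pairwise disjoint time windows, a set of dropped packets accommodates all rhythmic
packets exactly when the associated sets cover `X`. -/
theorem exists_injOn_slot_iff_biUnion_eq {α β : Type*} [DecidableEq α]
    {X : Finset α} {W : α → Finset ℕ}
    (hW : ∀ x ∈ X, ∀ y ∈ X, x ≠ y → Disjoint (W x) (W y))
    (T : β → Finset ℕ) (ρ : Finset β) :
    (∃ g : α → ℕ, Set.InjOn g ↑X ∧ ∀ x ∈ X, g x ∈ W x ∧ ∃ j ∈ ρ, g x ∈ T j) ↔
      ρ.biUnion (fun j => X.filter (fun x => (W x ∩ T j).Nonempty)) = X := by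
  constructor
  · rintro ⟨g, -, hg⟩
    refine Finset.Subset.antisymm
      (Finset.biUnion_subset.2 fun j _ => Finset.filter_subset _ _) fun x hx => ?_
    obtain ⟨hgW, j, hj, hgT⟩ := hg x hx
    exact Finset.mem_biUnion.2
      ⟨j, hj, Finset.mem_filter.2 ⟨hx, g x, Finset.mem_inter.2 ⟨hgW, hgT⟩⟩⟩
  · intro hρ
    have hslot : ∀ x, ∃ n, x ∈ X → n ∈ W x ∧ ∃ j ∈ ρ, n ∈ T j := by
      intro x
      by_cases hx : x ∈ X
      · obtain ⟨j, hj, hxj⟩ := Finset.mem_biUnion.1 (hρ.symm ▸ hx)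
        obtain ⟨-, n, hn⟩ := Finset.mem_filter.1 hxj
        obtain ⟨hnW, hnT⟩ := Finset.mem_inter.1 hn
        exact ⟨n, fun _ => ⟨hnW, j, hj, hnT⟩⟩
      · exact ⟨0, fun h => absurd h hx⟩
    choose g hg using hslot
    refine ⟨g, fun x hx y hy hxy => ?_, hg⟩
    by_contra hne
    exact Finset.disjoint_left.1 (hW x hx y hy hne) (hg x hx).1 (hxy ▸ (hg y hy).1)


/-- Optimum preservation in the packet dropping reduction: the minimum size of a
dropped periodic packet set accommodating all rhythmic packets equals the minimum
size of a subfamily of {C j} covering X. -/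
theorem packet_drop_set_cover_optimum {α β : Type*} [DecidableEq α] [DecidableEq β]
    (X : Finset α) (W : α → Finset ℕ)
    (hW : ∀ x ∈ X, ∀ y ∈ X, x ≠ y → Disjoint (W x) (W y))
    (J : Finset β) (T : β → Finset ℕ)
    (hcov : J.biUnion (fun j => X.filter (fun x => (W x ∩ T j).Nonempty)) = X) :
    sInf {n : ℕ | ∃ ρ : Finset β, ρ ⊆ J ∧ ρ.card = n ∧
        ∃ g : α → ℕ, Set.InjOn g ↑X ∧ ∀ x ∈ X, g x ∈ W x ∧ ∃ j ∈ ρ, g x ∈ T j} =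
    sInf {n : ℕ | ∃ ρ : Finset β, ρ ⊆ J ∧ ρ.card = n ∧
        ρ.biUnion (fun j => X.filter (fun x => (W x ∩ T j).Nonempty)) = X} := by
  simp only [exists_injOn_slot_iff_biUnion_eq hW]
end
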